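/- Let n ≥ 2 and 1 ≤ k ≤ n−1. Let K ⊆ ℝⁿ be a convex body with Bⁿ ⊆ K admitting a John decomposition u¹,…,uᵐ, λ₁,…,λₘ with ⟨x,uᵢ⟩ ≤ 1 for all x ∈ K and all i (i.e., Bⁿ is the John ellipsoid of K). Let s ≥ 1 be such that K ⊆ s·(−K), i.e., −(1/s)·x ∈ K for every x ∈ K. If E ⊆ K is a k-ellipsoid with orthonormal axis directions v¹,…,vᵏ, center c and semi-axes α₁,…,α_k > 0, then ∏ⱼ αⱼ ≤ ((n/k)·min{(s+1)/2, (n+1)/(k+1)})^{k/2} (equivalently vol_k(E) ≤ vol_k(√((n/k)·min{(s+1)/2,(n+1)/(k+1)})·Bᵏ)). -/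

import Mathlib

open scoped InnerProductSpace BigOperators

/-- Cauchy–Schwarz for weighted finite sums. -/
theorem sum_weight_mul_sq_le {ι : Type*} [Fintype ι] (lam f g : ι → ℝ) (hlam : ∀ i, 0 ≤ lam i) :
    (∑ i, lam i * (f i * g i)) ^ 2 ≤
      (∑ i, lam i * f i ^ 2) * ∑ i, lam i * g i ^ 2 := by
  have h := Finset.sum_mul_sq_le_sq_mul_sq Finset.univ
    (fun i => Real.sqrt (lam i) * f i) (fun i => Real.sqrt (lam i) * g i)
  have e : ∀ (i : ι) (x y : ℝ),
      Real.sqrt (lam i) * x * (Real.sqrt (lam i) * y) = lam i * (x * y) := fun i x y => by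
    linear_combination (x * y) * Real.mul_self_sqrt (hlam i)
  simpa only [e, pow_two] using h

/-- If a nonnegative weight `L` has total mass at most `S` and first moments `β`, `P` against
`d`, `r`, where `(d, r)` lies in a disc of radius `ρ`, then `(β, P)` has length at most `ρ S`. -/
theorem sq_add_sq_moments_le {ι : Type*} [Fintype ι] (lam L d r : ι → ℝ) {S β P ρ : ℝ}
    (hlam : ∀ i, 0 ≤ lam i) (hL : ∀ i, 0 ≤ L i) (hρ : 0 ≤ ρ)
    (hdr : ∀ i, d i ^ 2 + r i ^ 2 ≤ ρ ^ 2)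
    (hS : ∑ i, lam i * L i = S) (hβ : ∑ i, lam i * (L i * d i) = β)
    (hP : ∑ i, lam i * (L i * r i) = P) :
    β ^ 2 + P ^ 2 ≤ (ρ * S) ^ 2 := by
  have hS0 : 0 ≤ S := hS ▸ Finset.sum_nonneg fun i _ => mul_nonneg (hlam i) (hL i)
  set M := Real.sqrt (β ^ 2 + P ^ 2) with hM
  have hM0 : 0 ≤ M := Real.sqrt_nonneg _
  have hMsq : M ^ 2 = β ^ 2 + P ^ 2 := Real.sq_sqrt (by positivity)
  have hpt : ∀ i, d i * β + r i * P ≤ ρ * M := fun i => by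
    refine abs_le_of_sq_le_sq' ?_ (by positivity) |>.2
    nlinarith [sq_nonneg (d i * P - r i * β), mul_le_mul_of_nonneg_right (hdr i) (sq_nonneg M)]
  have hsum : β ^ 2 + P ^ 2 ≤ ρ * M * S := by
    calc β ^ 2 + P ^ 2 = ∑ i, lam i * L i * (d i * β + r i * P) := by
          rw [pow_two, pow_two]
          nth_rewrite 1 [← hβ]
          nth_rewrite 1 [← hP]
          rw [Finset.sum_mul, Finset.sum_mul, ← Finset.sum_add_distrib]
          exact Finset.sum_congr rfl fun i _ => by ring
      _ ≤ ∑ i, lam i * L i * (ρ * M) := Finset.sum_le_sum fun i _ =>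
          mul_le_mul_of_nonneg_left (hpt i) (mul_nonneg (hlam i) (hL i))
      _ = ρ * M * S := by rw [← Finset.sum_mul, hS]; ring
  rw [← hMsq] at hsum ⊢
  rcases hM0.eq_or_lt with h | h
  · rw [← h, zero_pow two_ne_zero]; positivity
  · have : M ≤ ρ * S := by nlinarith
    gcongr

/-- The elementary inequality concluding the bound on the trace: `a` is the trace, `a'` the sum
of `‖q‖ ‖Aq‖`, `t` the trace of the square. -/
theorem trace_sq_le_of_moments {k a a' t G R β N : ℝ} (hk : 1 ≤ k) (ha : 0 ≤ a) (haa : a ≤ a')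
    (hG : 0 ≤ G) (hR : 0 ≤ R) (hRsq : R ^ 2 ≤ 2 * a' * (a' - a)) (hat : a' ^ 2 ≤ k * t)
    (hvar : a ^ 2 ≤ k * t) (ht : t ≤ β ^ 2 + G ^ 2) (h0 : β ^ 2 + a' ^ 2 ≤ N)
    (h1 : 0 ≤ a' + G - R → β ^ 2 + (a' + G - R) ^ 2 ≤ N) :
    a ^ 2 * (1 + 1 / k) ≤ N := by
  have hk0 : 0 < k := by linarith
  obtain ⟨c, hc⟩ : ∃ c, c = a / k := ⟨_, rfl⟩
  have hac : a = k * c := by rw [hc]; field_simp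
  have hc0 : 0 ≤ c := by rw [hc]; positivity
  have htarget : a ^ 2 * (1 + 1 / k) = a ^ 2 + a * c := by rw [hc]; field_simp
  rw [htarget]
  by_cases hcase : a ^ 2 + a * c ≤ a' ^ 2
  · nlinarith [sq_nonneg β]
  push Not at hcase
  have hsmall : a' - a ≤ c / 2 := by
    by_contra! h
    nlinarith [sq_nonneg c]
  have hca : c ≤ a := by nlinarith
  obtain ⟨V, hV0, hV⟩ : ∃ V, 0 ≤ V ∧ V ^ 2 = t - a * c := by
    refine ⟨Real.sqrt (t - a * c), Real.sqrt_nonneg _, Real.sq_sqrt ?_⟩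
    have : k * (a * c) ≤ k * t := by
      calc k * (a * c) = a ^ 2 := by rw [hac]; ring
        _ ≤ k * t := hvar
    linarith [le_of_mul_le_mul_left this hk0]
  have hdiff : a' - a ≤ V := by
    by_contra! h
    have hVc : V < c / 2 := by linarith
    have h2 : a' ^ 2 ≤ k * V ^ 2 + a ^ 2 := by
      have : k * V ^ 2 + a ^ 2 = k * t := by rw [hV, hac]; ring
      linarith
    have h3 : k * V ≤ a / 2 := by nlinarith
    nlinarith [mul_le_mul_of_nonneg_right h3 hV0]
  have hkey : R ^ 2 ≤ a' ^ 2 - a ^ 2 + V ^ 2 := by nlinarith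
  have hRa : R ≤ a' := by
    refine abs_le_of_sq_le_sq' ?_ (by linarith) |>.2
    nlinarith
  rcases le_total G R with h | h
  · nlinarith
  · have := h1 (by linarith)
    nlinarith [mul_nonneg (sub_nonneg.2 h) (sub_nonneg.2 hRa)]

theorem norm_smul_sub_smul_norm_sq {E : Type*} [NormedAddCommGroup E] [InnerProductSpace ℝ E]
    (q y : E) :
    ‖‖y‖ • q - ‖q‖ • y‖ ^ 2 = 2 * (‖q‖ * ‖y‖) * (‖q‖ * ‖y‖ - ⟪q, y⟫_ℝ) := by
  rw [norm_sub_sq_real, norm_smul, norm_smul, inner_smul_left, inner_smul_right]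
  simp
  ring

/-- Trace bound for a diagonal map `A = diag α` such that `‖A q‖ ≤ β d + ⟪g, q⟫` on the support
of a discrete isotropic measure in `ℝ × ℝᵏ` contained in a ball of radius `ρ`. -/
theorem trace_sq_le_of_isotropic {ι : Type*} [Fintype ι] {k : ℕ} (hk : 1 ≤ k)
    (lam d b : ι → ℝ) (q y : ι → EuclideanSpace ℝ (Fin k)) (g : EuclideanSpace ℝ (Fin k))
    (α : Fin k → ℝ) {S β ρ : ℝ} (hlam : ∀ i, 0 ≤ lam i) (hα : ∀ j, 0 ≤ α j) (hρ : 0 ≤ ρ)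
    (hy : ∀ i j, y i j = α j * q i j)
    (hb : ∀ i, b i = β * d i + ⟪g, q i⟫_ℝ) (hyb : ∀ i, ‖y i‖ ≤ b i)
    (hx : ∀ i, d i ^ 2 + ‖q i‖ ^ 2 ≤ ρ ^ 2)
    (hdd : ∑ i, lam i * d i ^ 2 = 1) (hdq : ∀ z, ∑ i, lam i * (d i * ⟪z, q i⟫_ℝ) = 0)
    (hqq : ∀ z z', ∑ i, lam i * (⟪z, q i⟫_ℝ * ⟪z', q i⟫_ℝ) = ⟪z, z'⟫_ℝ)
    (hq : ∀ z, ∑ i, lam i * ⟪z, q i⟫_ℝ = 0) (hS : ∑ i, lam i * b i = S) :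
    (∑ j, α j) ^ 2 * (1 + 1 / k) ≤ (ρ * S) ^ 2 := by
  have hq1 : ∀ j, ∑ i, lam i * q i j ^ 2 = 1 := fun j => by
    have := hqq (EuclideanSpace.single j 1) (EuclideanSpace.single j 1)
    simpa [EuclideanSpace.inner_single_left, pow_two] using this
  have hweighted : ∀ c : Fin k → ℝ, ∑ i, lam i * ∑ j, c j * q i j ^ 2 = ∑ j, c j := fun c => by
    simp only [Finset.mul_sum]
    rw [Finset.sum_comm]
    refine Finset.sum_congr rfl fun j _ => ?_
    calc ∑ i, lam i * (c j * q i j ^ 2) = c j * ∑ i, lam i * q i j ^ 2 := by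
          rw [Finset.mul_sum]
          exact Finset.sum_congr rfl fun i _ => by ring
      _ = c j := by rw [hq1, mul_one]
  have hqn : ∀ i, ‖q i‖ ^ 2 = ∑ j, 1 * q i j ^ 2 := fun i => by
    simp [EuclideanSpace.norm_sq_eq]
  have hyn : ∀ i, ‖y i‖ ^ 2 = ∑ j, α j ^ 2 * q i j ^ 2 := fun i => by
    simp [EuclideanSpace.norm_sq_eq, hy, mul_pow]
  have hqy : ∀ i, ⟪q i, y i⟫_ℝ = ∑ j, α j * q i j ^ 2 := fun i => by
    simp only [PiLp.inner_apply, hy]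
    exact Finset.sum_congr rfl fun j _ => by simp; ring
  have hqsum : ∑ i, lam i * ‖q i‖ ^ 2 = k := by simp only [hqn, hweighted]; simp
  have hysum : ∑ i, lam i * ‖y i‖ ^ 2 = ∑ j, α j ^ 2 := by simp only [hyn, hweighted]
  have hqysum : ∑ i, lam i * ⟪q i, y i⟫_ℝ = ∑ j, α j := by simp only [hqy, hweighted]
  have hb0 : ∀ i, 0 ≤ b i := fun i => (norm_nonneg _).trans (hyb i)
  -- moments of `b`
  have hbd : ∀ z, ∑ i, lam i * ((b i + ⟪z, q i⟫_ℝ) * d i) = β := fun z => by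
    have : ∀ i, lam i * ((b i + ⟪z, q i⟫_ℝ) * d i) =
        β * (lam i * d i ^ 2) + lam i * (d i * ⟪g, q i⟫_ℝ) + lam i * (d i * ⟪z, q i⟫_ℝ) :=
      fun i => by rw [hb i]; ring
    simp only [this, Finset.sum_add_distrib, ← Finset.mul_sum, hdd, hdq]
    ring
  have hbq : ∀ z, ∑ i, lam i * (b i * ⟪z, q i⟫_ℝ) = ⟪g, z⟫_ℝ := fun z => by
    have : ∀ i, lam i * (b i * ⟪z, q i⟫_ℝ) =
        β * (lam i * (d i * ⟪z, q i⟫_ℝ)) + lam i * (⟪g, q i⟫_ℝ * ⟪z, q i⟫_ℝ) :=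
      fun i => by rw [hb i]; ring
    simp only [this, Finset.sum_add_distrib, ← Finset.mul_sum, hdq, hqq]
    ring
  have hbb : ∑ i, lam i * b i ^ 2 = β ^ 2 + ‖g‖ ^ 2 := by
    have : ∀ i, lam i * b i ^ 2 = β * (lam i * ((b i + ⟪(0 : EuclideanSpace ℝ (Fin k)), q i⟫_ℝ)
        * d i)) + lam i * (b i * ⟪g, q i⟫_ℝ) :=
      fun i => by rw [inner_zero_left, hb i]; ring
    simp only [this, Finset.sum_add_distrib, ← Finset.mul_sum, hbd, hbq, real_inner_self_eq_norm_sq]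
    ring
  set a' := ∑ i, lam i * (‖q i‖ * ‖y i‖) with ha'
  set R := ∑ i, lam i * ‖‖y i‖ • q i - ‖q i‖ • y i‖ with hR
  have haa : ∑ j, α j ≤ a' := by
    rw [← hqysum]
    exact Finset.sum_le_sum fun i _ =>
      mul_le_mul_of_nonneg_left (real_inner_le_norm _ _) (hlam i)
  have ha0 : 0 ≤ ∑ j, α j := Finset.sum_nonneg fun j _ => hα j
  have hR0 : 0 ≤ R := Finset.sum_nonneg fun i _ => mul_nonneg (hlam i) (norm_nonneg _)
  have hRsq : R ^ 2 ≤ 2 * a' * (a' - ∑ j, α j) := by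
    have h := sum_weight_mul_sq_le lam (fun i => Real.sqrt (2 * (‖q i‖ * ‖y i‖)))
      (fun i => Real.sqrt (‖q i‖ * ‖y i‖ - ⟪q i, y i⟫_ℝ)) hlam
    have e1 : ∀ i, Real.sqrt (2 * (‖q i‖ * ‖y i‖)) * Real.sqrt (‖q i‖ * ‖y i‖ - ⟪q i, y i⟫_ℝ) =
        ‖‖y i‖ • q i - ‖q i‖ • y i‖ := fun i => by
      rw [← Real.sqrt_mul (by positivity), ← norm_smul_sub_smul_norm_sq,
        Real.sqrt_sq (norm_nonneg _)]
    have e2 : ∀ i, Real.sqrt (2 * (‖q i‖ * ‖y i‖)) ^ 2 = 2 * (‖q i‖ * ‖y i‖) := fun i =>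
      Real.sq_sqrt (by positivity)
    have e3 : ∀ i, Real.sqrt (‖q i‖ * ‖y i‖ - ⟪q i, y i⟫_ℝ) ^ 2 =
        ‖q i‖ * ‖y i‖ - ⟪q i, y i⟫_ℝ := fun i =>
      Real.sq_sqrt (sub_nonneg.2 (real_inner_le_norm _ _))
    simp only [e1, e2, e3, mul_sub, Finset.sum_sub_distrib, hqysum] at h
    refine h.trans_eq ?_
    rw [← mul_sub, ha', Finset.mul_sum]
    congr 1
    exact Finset.sum_congr rfl fun i _ => by ring
  have hat : a' ^ 2 ≤ k * ∑ j, α j ^ 2 := by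
    have h := sum_weight_mul_sq_le lam (fun i => ‖q i‖) (fun i => ‖y i‖) hlam
    rwa [hqsum, hysum] at h
  have hvar : (∑ j, α j) ^ 2 ≤ k * ∑ j, α j ^ 2 := (pow_le_pow_left₀ ha0 haa 2).trans hat
  have ht : ∑ j, α j ^ 2 ≤ β ^ 2 + ‖g‖ ^ 2 := by
    rw [← hbb, ← hysum]
    exact Finset.sum_le_sum fun i _ => mul_le_mul_of_nonneg_left
      (pow_le_pow_left₀ (norm_nonneg _) (hyb i) 2) (hlam i)
  have hbmom := sq_add_sq_moments_le lam b d (fun i => ‖q i‖) hlam hb0 hρ hx hS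
    (by simpa using hbd 0) rfl
  have hPb : a' ≤ ∑ i, lam i * (b i * ‖q i‖) := Finset.sum_le_sum fun i _ =>
    mul_le_mul_of_nonneg_left (by rw [mul_comm]; gcongr; exact hyb i) (hlam i)
  refine trace_sq_le_of_moments (by exact_mod_cast hk) ha0 haa (norm_nonneg g) hR0 hRsq hat hvar ht
    ?_ fun hnn => ?_
  · have : a' ^ 2 ≤ (∑ i, lam i * (b i * ‖q i‖)) ^ 2 := by
      have : 0 ≤ a' := ha0.trans haa
      gcongr
    linarith
  · set e : EuclideanSpace ℝ (Fin k) := ‖g‖⁻¹ • g with he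
    have hge : ⟪g, e⟫_ℝ = ‖g‖ := by
      rw [he, inner_smul_right, real_inner_self_eq_norm_sq]
      rcases eq_or_ne ‖g‖ 0 with h | h
      · simp [h]
      · field_simp
    have he1 : ‖e‖ ≤ 1 := by
      rw [he, norm_smul, norm_inv, norm_norm]
      exact inv_mul_le_one
    set z : EuclideanSpace ℝ (Fin k) := WithLp.toLp 2 fun j => α j * e j with hz
    have hzq : ∀ i, ⟪z, q i⟫_ℝ = ⟪e, y i⟫_ℝ := fun i => by
      simp only [PiLp.inner_apply, hy, hz]
      exact Finset.sum_congr rfl fun j _ => by simp; ring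
    have hinner : ∀ x : EuclideanSpace ℝ (Fin k), |⟪e, x⟫_ℝ| ≤ ‖x‖ := fun x =>
      (abs_real_inner_le_norm e x).trans (mul_le_of_le_one_left (norm_nonneg _) he1)
    have hL0 : ∀ i, 0 ≤ b i + ⟪z, q i⟫_ℝ := fun i => by
      rw [hzq]
      linarith [(abs_le.1 (hinner (y i))).1, hyb i]
    have hLS : ∑ i, lam i * (b i + ⟪z, q i⟫_ℝ) = S := by
      simp only [mul_add, Finset.sum_add_distrib, hS, hq, add_zero]
    have hmom := sq_add_sq_moments_le lam _ d (fun i => ‖q i‖) hlam hL0 hρ hx hLS (hbd z) rfl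
    have hP : a' + ‖g‖ - R ≤ ∑ i, lam i * ((b i + ⟪z, q i⟫_ℝ) * ‖q i‖) := by
      rw [← hge, ← hbq e, ha', hR, ← Finset.sum_add_distrib, ← Finset.sum_sub_distrib]
      refine Finset.sum_le_sum fun i _ => ?_
      rw [← mul_add, ← mul_sub]
      refine mul_le_mul_of_nonneg_left ?_ (hlam i)
      have h1 := (abs_le.1 (hinner (‖y i‖ • q i - ‖q i‖ • y i))).2
      rw [inner_sub_right, inner_smul_right, inner_smul_right] at h1
      rw [hzq]
      nlinarith [mul_nonneg (sub_nonneg.2 (hyb i))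
        (sub_nonneg.2 (abs_le.1 (hinner (q i))).2)]
    have := pow_le_pow_left₀ hnn hP 2
    linarith

section JohnDecomposition

variable {n : ℕ} {ι : Type*} [Fintype ι] {u : ι → EuclideanSpace ℝ (Fin n)} {lam : ι → ℝ}

theorem sum_weight_inner_mul_inner
    (hdecomp : ∀ x : EuclideanSpace ℝ (Fin n), ∑ i, (lam i * ⟪u i, x⟫_ℝ) • u i = x)
    (x y : EuclideanSpace ℝ (Fin n)) :
    ∑ i, lam i * (⟪x, u i⟫_ℝ * ⟪y, u i⟫_ℝ) = ⟪x, y⟫_ℝ := by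
  conv_rhs => rw [← hdecomp y, inner_sum]
  refine Finset.sum_congr rfl fun i _ => ?_
  rw [inner_smul_right, real_inner_comm y (u i)]
  ring

theorem sum_weight_inner (hsum : ∑ i, lam i • u i = 0) (x : EuclideanSpace ℝ (Fin n)) :
    ∑ i, lam i * ⟪x, u i⟫_ℝ = 0 := by
  have h : ⟪x, ∑ i, lam i • u i⟫_ℝ = 0 := by rw [hsum, inner_zero_right]
  simpa only [inner_sum, inner_smul_right] using h

theorem sum_weight (hu : ∀ i, ‖u i‖ = 1)
    (hdecomp : ∀ x : EuclideanSpace ℝ (Fin n), ∑ i, (lam i * ⟪u i, x⟫_ℝ) • u i = x) :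
    ∑ i, lam i = n := by
  calc ∑ i, lam i = ∑ i, lam i * ∑ j, u i j ^ 2 := Finset.sum_congr rfl fun i _ => by
        have h := EuclideanSpace.norm_sq_eq (u i)
        simp only [hu, Real.norm_eq_abs, sq_abs] at h
        rw [← h]; ring
    _ = ∑ j : Fin n, ∑ i, lam i * u i j ^ 2 := by
        simp only [Finset.mul_sum]
        exact Finset.sum_comm
    _ = ∑ j : Fin n, (1 : ℝ) := Finset.sum_congr rfl fun j _ => by
        have h := sum_weight_inner_mul_inner hdecomp (EuclideanSpace.single j 1)
          (EuclideanSpace.single j 1)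
        simpa [EuclideanSpace.inner_single_left, pow_two] using h
    _ = n := by simp

/-- Sum of the squared semi-axes, from the asymmetry bound. -/
theorem sum_sq_semiaxes_le {k : ℕ} {α : Fin k → ℝ} {v : Fin k → EuclideanSpace ℝ (Fin n)}
    {c : EuclideanSpace ℝ (Fin n)} {s : ℝ} (hlam : ∀ i, 0 ≤ lam i)
    (hu : ∀ i, ‖u i‖ = 1) (hsum : ∑ i, lam i • u i = 0)
    (hdecomp : ∀ x : EuclideanSpace ℝ (Fin n), ∑ i, (lam i * ⟪u i, x⟫_ℝ) • u i = x)
    (hv : Orthonormal ℝ v)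
    (hupper : ∀ i, Real.sqrt (∑ j, (α j * ⟪v j, u i⟫_ℝ) ^ 2) ≤ 1 - ⟪c, u i⟫_ℝ)
    (hlower : ∀ i, Real.sqrt (∑ j, (α j * ⟪v j, u i⟫_ℝ) ^ 2) ≤ s + ⟪c, u i⟫_ℝ) :
    ∑ j, α j ^ 2 ≤ n * ((s + 1) / 2) := by
  calc ∑ j, α j ^ 2 = ∑ i, lam i * ∑ j, (α j * ⟪v j, u i⟫_ℝ) ^ 2 := by
        simp only [Finset.mul_sum]
        rw [Finset.sum_comm]
        refine Finset.sum_congr rfl fun j _ => ?_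
        have h := sum_weight_inner_mul_inner hdecomp (v j) (v j)
        rw [real_inner_self_eq_norm_sq, hv.1 j] at h
        calc α j ^ 2 = α j ^ 2 * ∑ i, lam i * (⟪v j, u i⟫_ℝ * ⟪v j, u i⟫_ℝ) := by rw [h]; ring
          _ = _ := by
            rw [Finset.mul_sum]
            exact Finset.sum_congr rfl fun i _ => by ring
    _ ≤ ∑ i, lam i * ((1 - ⟪c, u i⟫_ℝ) * ((s + 1) / 2)) := by
        refine Finset.sum_le_sum fun i _ => mul_le_mul_of_nonneg_left ?_ (hlam i)
        have h0 : 0 ≤ ∑ j, (α j * ⟪v j, u i⟫_ℝ) ^ 2 := Finset.sum_nonneg fun j _ => sq_nonneg _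
        rw [← Real.sq_sqrt h0, pow_two]
        refine mul_le_mul (hupper i) ?_ (Real.sqrt_nonneg _)
          ((Real.sqrt_nonneg _).trans (hupper i))
        linarith [hupper i, hlower i]
    _ = (∑ i, lam i - ∑ i, lam i * ⟪c, u i⟫_ℝ) * ((s + 1) / 2) := by
        rw [← Finset.sum_sub_distrib, Finset.sum_mul]
        exact Finset.sum_congr rfl fun i _ => by ring
    _ = n * ((s + 1) / 2) := by
        rw [sum_weight hu hdecomp, sum_weight_inner hsum, sub_zero]

/-- Ball's bound for the sum of the semi-axes of an ellipsoid in a body in John position. -/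
theorem sum_semiaxes_sq_le {k : ℕ} (hn : 1 ≤ n) (hk : 1 ≤ k) {α : Fin k → ℝ}
    {v : Fin k → EuclideanSpace ℝ (Fin n)}
    {c : EuclideanSpace ℝ (Fin n)} (hlam : ∀ i, 0 ≤ lam i) (hα : ∀ j, 0 ≤ α j)
    (hu : ∀ i, ‖u i‖ = 1) (hsum : ∑ i, lam i • u i = 0)
    (hdecomp : ∀ x : EuclideanSpace ℝ (Fin n), ∑ i, (lam i * ⟪u i, x⟫_ℝ) • u i = x)
    (hv : Orthonormal ℝ v)
    (hupper : ∀ i, Real.sqrt (∑ j, (α j * ⟪v j, u i⟫_ℝ) ^ 2) ≤ 1 - ⟪c, u i⟫_ℝ) :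
    (∑ j, α j) ^ 2 * (1 + 1 / k) ≤ n * (n + 1) := by
  have hn0 : (0 : ℝ) < n := by exact_mod_cast hn
  have hmass := sum_weight hu hdecomp
  have hmean := sum_weight_inner hsum
  have hiso := sum_weight_inner_mul_inner hdecomp
  let T : EuclideanSpace ℝ (Fin k) → EuclideanSpace ℝ (Fin n) := fun z => ∑ j, z j • v j
  let coord : EuclideanSpace ℝ (Fin n) → EuclideanSpace ℝ (Fin k) :=
    fun x => WithLp.toLp 2 fun j => ⟪v j, x⟫_ℝ
  have hTx : ∀ z x, ⟪T z, x⟫_ℝ = ⟪z, coord x⟫_ℝ := fun z x => by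
    simp only [T, coord, sum_inner, inner_smul_left, PiLp.inner_apply]
    exact Finset.sum_congr rfl fun j _ => by simp; ring
  have hcT : ∀ z, coord (T z) = z := fun z => by
    ext j
    simp only [coord, T]
    exact hv.inner_right_fintype _ j
  have hTT : ∀ z z', ⟪T z, T z'⟫_ℝ = ⟪z, z'⟫_ℝ := fun z z' => by rw [hTx, hcT]
  set p : EuclideanSpace ℝ (Fin n) := c - T (coord c) with hp
  have hpT : ∀ z, ⟪p, T z⟫_ℝ = 0 := fun z => by
    rw [hp, inner_sub_left, hTT, real_inner_comm, hTx, real_inner_comm, sub_self]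
  set β := Real.sqrt (n + ‖p‖ ^ 2) with hβ
  have hβsq : β ^ 2 = n + ‖p‖ ^ 2 := Real.sq_sqrt (by positivity)
  have hβ0 : 0 < β := Real.sqrt_pos.2 (by positivity)
  have hρsq : Real.sqrt ((n + 1) / n) ^ 2 = ((n : ℝ) + 1) / n := Real.sq_sqrt (by positivity)
  have hsumD : ∀ z, ∑ i, lam i * ((1 - ⟪p, u i⟫_ℝ) * ⟪z, u i⟫_ℝ) = -⟪p, z⟫_ℝ := fun z => by
    have : ∀ i, lam i * ((1 - ⟪p, u i⟫_ℝ) * ⟪z, u i⟫_ℝ) =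
        lam i * ⟪z, u i⟫_ℝ - lam i * (⟪p, u i⟫_ℝ * ⟪z, u i⟫_ℝ) := fun i => by ring
    simp only [this, Finset.sum_sub_distrib, hmean, hiso, zero_sub]
  have key := trace_sq_le_of_isotropic hk lam (fun i => (1 - ⟪p, u i⟫_ℝ) / β)
    (fun i => 1 - ⟪c, u i⟫_ℝ) (fun i => coord (u i))
    (fun i => WithLp.toLp 2 fun j => α j * ⟪v j, u i⟫_ℝ) (-coord c) α
    (S := n) (β := β) (ρ := Real.sqrt ((n + 1) / n)) hlam hα (Real.sqrt_nonneg _)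
    (fun i j => rfl) (fun i => ?_) (fun i => ?_) (fun i => ?_) ?_ (fun z => ?_)
    (fun z z' => ?_) (fun z => ?_) ?_
  · rw [mul_pow, hρsq] at key
    refine key.trans_eq ?_
    field_simp
  · rw [mul_div_cancel₀ _ hβ0.ne', inner_neg_left, ← hTx, hp, inner_sub_left]
    ring
  · rw [EuclideanSpace.norm_eq]
    simpa only [Real.norm_eq_abs, sq_abs] using hupper i
  · set w := u i - T (coord (u i)) with hw
    have hpw : ⟪p, u i⟫_ℝ = ⟪p, w⟫_ℝ := by rw [hw, inner_sub_right, hpT, sub_zero]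
    have hwn : ‖w‖ ^ 2 = 1 - ‖coord (u i)‖ ^ 2 := by
      rw [hw, norm_sub_sq_real, hu, real_inner_comm, hTx, ← real_inner_self_eq_norm_sq (T _), hTT,
        real_inner_self_eq_norm_sq]
      ring
    have hcs := abs_le.1 (abs_real_inner_le_norm p w)
    rw [hρsq, div_pow, hβsq, hpw]
    have hD : (1 - ⟪p, w⟫_ℝ) ^ 2 ≤ (n + ‖p‖ ^ 2) * (1 / n + ‖w‖ ^ 2) := by
      have h1 : (1 - ⟪p, w⟫_ℝ) ^ 2 ≤ (1 + ‖p‖ * ‖w‖) ^ 2 := by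
        refine sq_le_sq' ?_ ?_ <;> linarith [hcs.1, hcs.2]
      have h2 : (n + ‖p‖ ^ 2) * (1 / n + ‖w‖ ^ 2) - (1 + ‖p‖ * ‖w‖) ^ 2 =
          (n * ‖w‖ - ‖p‖) ^ 2 / n := by
        field_simp
        ring
      have h3 : 0 ≤ (n * ‖w‖ - ‖p‖) ^ 2 / n := by positivity
      linarith
    have hpos : (0 : ℝ) < n + ‖p‖ ^ 2 := by positivity
    have h4 : (1 - ⟪p, w⟫_ℝ) ^ 2 / (n + ‖p‖ ^ 2) ≤ 1 / n + ‖w‖ ^ 2 := by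
      rw [div_le_iff₀ hpos]
      linarith
    have h5 : ((n : ℝ) + 1) / n = 1 + 1 / n := by field_simp
    rw [h5]
    linarith
  · have : ∀ i, lam i * ((1 - ⟪p, u i⟫_ℝ) / β) ^ 2 =
        (lam i - lam i * ⟪p, u i⟫_ℝ - lam i * ((1 - ⟪p, u i⟫_ℝ) * ⟪p, u i⟫_ℝ)) / β ^ 2 :=
      fun i => by rw [div_pow]; ring
    simp only [this]
    rw [← Finset.sum_div, Finset.sum_sub_distrib, Finset.sum_sub_distrib, hmass, hmean, hsumD,
      real_inner_self_eq_norm_sq, sub_zero, sub_neg_eq_add, ← hβsq]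
    exact div_self (by positivity)
  · have : ∀ i, lam i * ((1 - ⟪p, u i⟫_ℝ) / β * ⟪z, coord (u i)⟫_ℝ) =
        lam i * ((1 - ⟪p, u i⟫_ℝ) * ⟪T z, u i⟫_ℝ) / β := fun i => by rw [hTx]; ring
    simp only [this]
    rw [← Finset.sum_div, hsumD, hpT]
    simp
  · simp only [← hTx, hiso]
    rw [hTx, hcT]
  · simp only [← hTx, hmean]
  · simp only [mul_sub, mul_one, Finset.sum_sub_distrib, hmass, hmean, sub_zero]

end JohnDecomposition

/-- The support value of an ellipsoid in direction `u` is attained, on both sides. -/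
theorem exists_ellipsoid_support {E : Type*} [NormedAddCommGroup E] [InnerProductSpace ℝ E]
    {k : ℕ} {α : Fin k → ℝ} (hα : ∀ j, 0 < α j) (v : Fin k → E) (u : E) :
    ∃ t : Fin k → ℝ, ∑ j, t j ^ 2 / α j ^ 2 ≤ 1 ∧
      ⟪∑ j, t j • v j, u⟫_ℝ = Real.sqrt (∑ j, (α j * ⟪v j, u⟫_ℝ) ^ 2) := by
  set w := Real.sqrt (∑ j, (α j * ⟪v j, u⟫_ℝ) ^ 2) with hw
  have hwsq : w ^ 2 = ∑ j, (α j * ⟪v j, u⟫_ℝ) ^ 2 :=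
    Real.sq_sqrt (Finset.sum_nonneg fun j _ => sq_nonneg _)
  refine ⟨fun j => α j ^ 2 * ⟪v j, u⟫_ℝ / w, ?_, ?_⟩
  · have : ∀ j, (α j ^ 2 * ⟪v j, u⟫_ℝ / w) ^ 2 / α j ^ 2 = (α j * ⟪v j, u⟫_ℝ) ^ 2 / w ^ 2 :=
      fun j => by
        have := (hα j).ne'
        rw [div_pow, div_right_comm]
        congr 1
        field_simp
    simp only [this]
    rw [← Finset.sum_div, ← hwsq]
    exact div_self_le_one _
  · have : ∀ j, ⟪(α j ^ 2 * ⟪v j, u⟫_ℝ / w) • v j, u⟫_ℝ = (α j * ⟪v j, u⟫_ℝ) ^ 2 / w :=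
      fun j => by rw [real_inner_smul_left]; ring
    rw [sum_inner]
    simp only [this]
    rw [← Finset.sum_div, ← hwsq, pow_two]
    exact mul_self_div_self w

/-- The inequality between arithmetic and geometric means, without roots. -/
theorem prod_le_mean_pow {k : ℕ} (hk : 1 ≤ k) {α : Fin k → ℝ} (hα : ∀ j, 0 ≤ α j) :
    ∏ j, α j ≤ ((∑ j, α j) / k) ^ k := by
  have hk0 : (0 : ℝ) < k := by exact_mod_cast hk
  have h := Real.geom_mean_le_arith_mean_weighted Finset.univ (fun _ => (1 : ℝ) / k) α
    (fun _ _ => by positivity) (by simp [hk0.ne']) (fun j _ => hα j)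
  rw [Real.finsetProd_rpow _ _ fun j _ => hα j, ← Finset.mul_sum, one_div_mul_eq_div] at h
  have hP : 0 ≤ ∏ j, α j := Finset.prod_nonneg fun j _ => hα j
  calc ∏ j, α j = ((∏ j, α j) ^ ((1 : ℝ) / k)) ^ k := by
        rw [← Real.rpow_natCast, ← Real.rpow_mul hP, one_div_mul_cancel hk0.ne', Real.rpow_one]
    _ ≤ _ := pow_le_pow_left₀ (Real.rpow_nonneg hP _) h k

/-- Theorem on maximal ellipsoids contained in a body in John position,
with the John asymmetry bound. -/
theorem stmt6 (n k : ℕ) (hn : 2 ≤ n) (hk : 1 ≤ k) (hkn : k ≤ n - 1)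
    (K : Set (EuclideanSpace ℝ (Fin n)))
    (hKcompact : IsCompact K) (hKconv : Convex ℝ K) (hKint : (interior K).Nonempty)
    (hBK : Metric.closedBall 0 1 ⊆ K)
    (m : ℕ) (u : Fin m → EuclideanSpace ℝ (Fin n)) (lam : Fin m → ℝ)
    (hu : ∀ i, ‖u i‖ = 1) (hlam : ∀ i, 0 < lam i)
    (hsum : ∑ i, lam i • u i = 0)
    (hdecomp : ∀ x : EuclideanSpace ℝ (Fin n), ∑ i, (lam i * ⟪u i, x⟫_ℝ) • u i = x)
    (hsupp : ∀ x ∈ K, ∀ i, ⟪x, u i⟫_ℝ ≤ 1)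
    (s : ℝ) (hs : 1 ≤ s) (hsym : ∀ x ∈ K, -(s⁻¹ • x) ∈ K)
    (v : Fin k → EuclideanSpace ℝ (Fin n)) (hv : Orthonormal ℝ v)
    (c : EuclideanSpace ℝ (Fin n))
    (α : Fin k → ℝ) (hα : ∀ j, 0 < α j)
    (Eell : Set (EuclideanSpace ℝ (Fin n)))
    (hEell : Eell = {x | ∃ t : Fin k → ℝ,
      ∑ j, (t j) ^ 2 / (α j) ^ 2 ≤ 1 ∧ x = c + ∑ j, t j • v j})
    (hEK : Eell ⊆ K) :
    ∏ j, α j ≤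
      Real.sqrt (((n : ℝ) / k) * min ((s + 1) / 2) (((n : ℝ) + 1) / ((k : ℝ) + 1))) ^ k := by
  have hk0 : (0 : ℝ) < k := by exact_mod_cast hk
  have hn0 : (0 : ℝ) < n := by positivity
  have hs0 : 0 < s := by linarith
  have hlam' : ∀ i, 0 ≤ lam i := fun i => (hlam i).le
  have hα' : ∀ j, 0 ≤ α j := fun j => (hα j).le
  have hmem : ∀ t : Fin k → ℝ, ∑ j, t j ^ 2 / α j ^ 2 ≤ 1 → c + ∑ j, t j • v j ∈ K :=
    fun t ht => hEK (hEell ▸ ⟨t, ht, rfl⟩)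
  have hupper : ∀ i, Real.sqrt (∑ j, (α j * ⟪v j, u i⟫_ℝ) ^ 2) ≤ 1 - ⟪c, u i⟫_ℝ := fun i => by
    obtain ⟨t, ht, htu⟩ := exists_ellipsoid_support hα v (u i)
    have h := hsupp _ (hmem t ht) i
    rw [inner_add_left, htu] at h
    linarith
  have hlower : ∀ i, Real.sqrt (∑ j, (α j * ⟪v j, u i⟫_ℝ) ^ 2) ≤ s + ⟪c, u i⟫_ℝ := fun i => by
    obtain ⟨t, ht, htu⟩ := exists_ellipsoid_support hα v (u i)
    have h := hsupp _ (hsym _ (hmem (fun j => -t j) (by simpa using ht))) i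
    simp only [neg_smul, Finset.sum_neg_distrib] at h
    rw [inner_neg_left, real_inner_smul_left, inner_add_left, inner_neg_left, htu,
      ← mul_neg, inv_mul_le_iff₀ hs0] at h
    linarith
  have hsq := sum_sq_semiaxes_le hlam' hu hsum hdecomp hv hupper hlower
  have htr := sum_semiaxes_sq_le (by omega) hk hlam' hα' hu hsum hdecomp hv hupper
  have hcs : (∑ j, α j) ^ 2 ≤ k * ∑ j, α j ^ 2 := by
    simpa using sq_sum_le_card_mul_sum_sq (s := Finset.univ) (f := α)
  refine (prod_le_mean_pow hk hα').trans ?_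
  refine pow_le_pow_left₀ (div_nonneg (Finset.sum_nonneg fun j _ => hα' j) hk0.le) ?_ k
  refine Real.le_sqrt_of_sq_le ?_
  rw [mul_min_of_nonneg _ _ (by positivity)]
  refine le_min ?_ ?_
  · rw [div_pow, div_mul_eq_mul_div, div_le_div_iff₀ (by positivity) hk0]
    nlinarith
  · have hk1 : (1 : ℝ) + 1 / k = (k + 1) / k := by field_simp
    rw [hk1, mul_div_assoc', div_le_iff₀ hk0] at htr
    rw [div_pow, div_mul_div_comm, div_le_div_iff₀ (by positivity) (by positivity)]
    nlinarith
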